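/- Let θ and θ⋆ be real numbers with sin((θ⋆ + θ)/2) ≠ 0, and consider the singular configuration θ0 = θ1 = θ. Then there exists no pair (s, t) ∈ ℝ² such that the associated biarc matrix A satisfies A·(s, t)ᵀ = (1, 0)ᵀ; that is, the linear system is inconsistent unless the joint angle satisfies θ⋆ + θ ≡ 0 (mod 2π). -/

import Mathlib

noncomputable def sinc (x : ℝ) : ℝ := if x = 0 then 1 else Real.sin x / x
noncomputable def cosc (x : ℝ) : ℝ := if x = 0 then 0 else (1 - Real.cos x) / x

/-- The associated biarc matrix. -/
noncomputable def biarcA (θ0 θ1 θs : ℝ) : Matrix (Fin 2) (Fin 2) ℝ :=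
  !![Real.cos θ0 * sinc (θs - θ0) - Real.sin θ0 * cosc (θs - θ0),
     Real.cos θ1 * sinc (θs - θ1) - Real.sin θ1 * cosc (θs - θ1);
     Real.sin θ0 * sinc (θs - θ0) + Real.cos θ0 * cosc (θs - θ0),
     Real.sin θ1 * sinc (θs - θ1) + Real.cos θ1 * cosc (θs - θ1)]


theorem sinc_eq_cos_half_mul (x : ℝ) : sinc x = Real.cos (x / 2) * sinc (x / 2) := by
  by_cases hx : x = 0
  · simp [sinc, hx]
  · have hs : Real.sin x = 2 * Real.sin (x / 2) * Real.cos (x / 2) := by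
      rw [← Real.sin_two_mul, mul_div_cancel₀ x two_ne_zero]
    simp only [sinc, hx, div_eq_zero_iff, two_ne_zero, or_self, if_false, hs]
    field_simp

theorem cosc_eq_sin_half_mul (x : ℝ) : cosc x = Real.sin (x / 2) * sinc (x / 2) := by
  by_cases hx : x = 0
  · simp [cosc, hx]
  · have hc : 1 - Real.cos x = 2 * Real.sin (x / 2) ^ 2 := by
      rw [Real.sin_sq_eq_half_sub, mul_div_cancel₀ x two_ne_zero]
      ring
    simp only [cosc, sinc, hx, div_eq_zero_iff, two_ne_zero, or_self, if_false, hc]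
    field_simp

theorem cos_mul_sinc_sub_sin_mul_cosc (θ θs : ℝ) :
    Real.cos θ * sinc (θs - θ) - Real.sin θ * cosc (θs - θ) =
      Real.cos ((θs + θ) / 2) * sinc ((θs - θ) / 2) := by
  rw [sinc_eq_cos_half_mul (θs - θ), cosc_eq_sin_half_mul,
    show (θs + θ) / 2 = θ + (θs - θ) / 2 by ring, Real.cos_add]
  ring

theorem sin_mul_sinc_add_cos_mul_cosc (θ θs : ℝ) :
    Real.sin θ * sinc (θs - θ) + Real.cos θ * cosc (θs - θ) =
      Real.sin ((θs + θ) / 2) * sinc ((θs - θ) / 2) := by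
  rw [sinc_eq_cos_half_mul (θs - θ), cosc_eq_sin_half_mul,
    show (θs + θ) / 2 = θ + (θs - θ) / 2 by ring, Real.sin_add]
  ring

theorem biarc_singular_inconsistent (θ θs : ℝ) (h : Real.sin ((θs + θ) / 2) ≠ 0) :
    ¬ ∃ s t : ℝ, (biarcA θ θ θs).mulVec ![s, t] = ![1, 0] := by
  rintro ⟨s, t, hst⟩
  have h₀ := congrFun hst 0
  have h₁ := congrFun hst 1
  simp only [biarcA, cos_mul_sinc_sub_sin_mul_cosc, sin_mul_sinc_add_cos_mul_cosc,
    Matrix.mulVec, dotProduct, Fin.sum_univ_two, Matrix.of_apply, Matrix.cons_val_zero,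
    Matrix.cons_val_one] at h₀ h₁
  have hk : sinc ((θs - θ) / 2) * (s + t) = 0 :=
    (mul_eq_zero.mp (by linear_combination h₁ :
      Real.sin ((θs + θ) / 2) * (sinc ((θs - θ) / 2) * (s + t)) = 0)).resolve_left h
  exact one_ne_zero (by linear_combination Real.cos ((θs + θ) / 2) * hk - h₀ : (1 : ℝ) = 0)
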